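/- arXiv:2402.12495 — 9 statements merged into one kernel-verified Lean document; each statement's English description precedes it below -/
import Mathlib

section
/- Suppose ℓ ≥ 2 (i.e., X has at least two distinct first coordinates). Then for every integer t ≥ ℓ − 1, the ideal ⟨x_0,…,x_n⟩^t is contained in I_{X_ℓ} + ⋂_{k=1}^{ℓ−1} I_{X_k}. -/
open MvPolynomial

noncomputable section

/-- The Cox ring `S = k[x_0,…,x_n, y_0,…,y_m]` of `ℙⁿ × ℙᵐ`. -/
abbrev Cox (k : Type*) [Field k] (n m : ℕ) : Type _ :=
  MvPolynomial (Fin (n + 1) ⊕ Fin (m + 1)) k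

variable {k : Type*} [Field k] {n m : ℕ}

/-- The vanishing ideal `⟨a_i x_0 - x_i : 1 ≤ i ≤ n⟩` of the point
`[1 : a_1 : ⋯ : a_n] ∈ ℙⁿ`. -/
def Ia (n m : ℕ) (a : Fin n → k) : Ideal (Cox k n m) :=
  Ideal.span (Set.range fun i : Fin n =>
    C (a i) * X (Sum.inl 0) - X (Sum.inl i.succ))

/-- The vanishing ideal `⟨b_j y_0 - y_j : 1 ≤ j ≤ m⟩` of the point
`[1 : b_1 : ⋯ : b_m] ∈ ℙᵐ`. -/
def Ib (n m : ℕ) (b : Fin m → k) : Ideal (Cox k n m) :=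
  Ideal.span (Set.range fun j : Fin m =>
    C (b j) * X (Sum.inr 0) - X (Sum.inr j.succ))

/-- The ideal `⟨x_0, …, x_n⟩`. -/
def xIdeal (k : Type*) [Field k] (n m : ℕ) : Ideal (Cox k n m) :=
  Ideal.span (Set.range fun i : Fin (n + 1) => (X (Sum.inl i) : Cox k n m))

/-- The ideal `I_{X_a} = I_{P_a} + ⋂_j I_{Q_{a,j}}` of the fiber `X_a` of `X` over the
point `P_a ∈ ℙⁿ`. -/
def IXk {ℓ : ℕ} (n m : ℕ) (P : Fin ℓ → Fin n → k) (r : Fin ℓ → ℕ)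
    (Q : (a : Fin ℓ) → Fin (r a) → Fin m → k) (a : Fin ℓ) : Ideal (Cox k n m) :=
  Ia n m (P a) + ⨅ j : Fin (r a), Ib n m (Q a j)

theorem aux_x_le (P P' : Fin n → k) (h : P ≠ P') :
    xIdeal k n m ≤ Ia n m P ⊔ Ia n m P' := by
  obtain ⟨i, hi⟩ := Function.ne_iff.mp h
  have g1 : ∀ j : Fin n, (C (P j) * X (Sum.inl 0) - X (Sum.inl j.succ) : Cox k n m) ∈
      Ia n m P ⊔ Ia n m P' := fun j =>
    Ideal.mem_sup_left (Ideal.subset_span ⟨j, rfl⟩)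
  have g2 : ∀ j : Fin n, (C (P' j) * X (Sum.inl 0) - X (Sum.inl j.succ) : Cox k n m) ∈
      Ia n m P ⊔ Ia n m P' := fun j =>
    Ideal.mem_sup_right (Ideal.subset_span ⟨j, rfl⟩)
  have h0 : (X (Sum.inl 0) : Cox k n m) ∈ Ia n m P ⊔ Ia n m P' := by
    have h1 := Ideal.mul_mem_left _ (C ((P i - P' i)⁻¹)) (Ideal.sub_mem _ (g1 i) (g2 i))
    have h2 : (C ((P i - P' i)⁻¹) * C (P i - P' i) : Cox k n m) = 1 := by
      rw [← C_mul, inv_mul_cancel₀ (sub_ne_zero.mpr hi), C_1]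
    have h3 : (C ((P i - P' i)⁻¹) * ((C (P i) * X (Sum.inl 0) - X (Sum.inl i.succ)) -
        (C (P' i) * X (Sum.inl 0) - X (Sum.inl i.succ))) : Cox k n m) = X (Sum.inl 0) := by
      rw [C_sub] at h2
      linear_combination (X (Sum.inl 0) : Cox k n m) * h2
    rwa [h3] at h1
  refine Ideal.span_le.mpr ?_
  rintro _ ⟨j, rfl⟩
  refine Fin.cases h0 (fun j => ?_) j
  have h4 := Ideal.sub_mem _ (Ideal.mul_mem_left _ (C (P j)) h0) (g1 j)
  rwa [sub_sub_cancel] at h4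

theorem aux_prod {R ι : Type*} [CommRing R] (I : Ideal R) (J : ι → Ideal R) (s : Finset ι) :
    ∏ a ∈ s, (I ⊔ J a) ≤ I ⊔ ∏ a ∈ s, J a := by
  classical
  induction s using Finset.induction_on with
  | empty => simp
  | insert a s ha ih =>
    rw [Finset.prod_insert ha, Finset.prod_insert ha]
    refine (Ideal.mul_mono_right ih).trans ?_
    rw [Ideal.sup_mul]
    refine sup_le (le_trans (Ideal.mul_le_left) le_sup_left) ?_
    rw [Ideal.mul_sup]
    exact sup_le (le_trans Ideal.mul_le_right le_sup_left) le_sup_right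

/-- **Lemma 2.3** (key step): if `X ⊆ ℙⁿ × ℙᵐ` has `ℓ = L + 1 ≥ 2` distinct first
coordinates `P_1, …, P_ℓ`, then for every `t ≥ ℓ - 1` one has
`⟨x⟩^t ⊆ I_{X_ℓ} + ⋂_{a=1}^{ℓ-1} I_{X_a}`. -/
theorem stmt0 (k : Type*) [Field k] [IsAlgClosed k] (n m : ℕ) (hn : 1 ≤ n) (hm : 1 ≤ m)
    (L : ℕ) (hL : 1 ≤ L)
    (P : Fin (L + 1) → Fin n → k) (hP : Function.Injective P)
    (r : Fin (L + 1) → ℕ) (hr : ∀ a, 1 ≤ r a)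
    (Q : (a : Fin (L + 1)) → Fin (r a) → Fin m → k)
    (hQ : ∀ a, Function.Injective (Q a))
    (t : ℕ) (ht : L ≤ t) :
    xIdeal k n m ^ t ≤
      IXk n m P r Q (Fin.last L) + ⨅ a : Fin L, IXk n m P r Q a.castSucc := by
  refine (Ideal.pow_le_pow_right ht).trans ?_
  have h1 : xIdeal k n m ^ L ≤
      ∏ a : Fin L, (Ia n m (P (Fin.last L)) ⊔ Ia n m (P a.castSucc)) := by
    have : xIdeal k n m ^ L = ∏ a : Fin L, xIdeal k n m := by simp
    rw [this]
    refine Finset.prod_le_prod' fun a _ => aux_x_le _ _ fun h => ?_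
    exact (Fin.castSucc_lt_last a).ne' (hP h)
  refine (h1.trans (aux_prod _ _ _)).trans ?_
  refine sup_le_sup le_sup_left (le_iInf fun a => ?_)
  refine (Ideal.prod_le_inf.trans (Finset.inf_le (Finset.mem_univ a))).trans ?_
  exact le_sup_left
end
end

section
/- If i ≥ ℓ − 1, then for all j ≥ 0 there is an equality of bigraded pieces (⋂_{k=1}^{ℓ} (I_{X_k} + ⟨y_0⟩)) ∩ S_{(i,j)} = (I_X + ⟨y_0⟩) ∩ S_{(i,j)} (as k-subspaces of S_{(i,j)}). -/
open MvPolynomial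

noncomputable section

variable {k : Type*} [Field k] {n m : ℕ}

/-- The bigrading weight on the Cox ring: `deg x_i = (1,0)`, `deg y_j = (0,1)`. -/
def biweight (n m : ℕ) : Fin (n + 1) ⊕ Fin (m + 1) → ℕ × ℕ :=
  Sum.elim (fun _ => (1, 0)) (fun _ => (0, 1))

/-- The space `S_{(i,j)}` of bihomogeneous polynomials of bidegree `(i,j)`
(together with `0`), as a `k`-subspace of the Cox ring. -/
def bigradedPiece (k : Type*) [Field k] (n m : ℕ) (i j : ℕ) :
    Submodule k (Cox k n m) :=
  weightedHomogeneousSubmodule k (biweight n m) (i, j)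


def phiA (n m : ℕ) (a : Fin n → k) : Cox k n m →ₐ[k] Cox k n m :=
  aeval (Sum.elim (Fin.cases (X (Sum.inl 0)) (fun t => C (a t) * X (Sum.inl 0)))
    (fun s => X (Sum.inr s)))

def psiA (n m : ℕ) (a : Fin n → k) : Cox k n m →ₐ[k] Cox k n m :=
  aeval (Sum.elim (Fin.cases 1 (fun t => C (a t))) (fun s => X (Sum.inr s)))

lemma sub_phiA_mem (a : Fin n → k) (f : Cox k n m) : f - phiA n m a f ∈ Ia n m a := by
  rw [← Ideal.Quotient.mk_eq_mk_iff_sub_mem]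
  have h : (Ideal.Quotient.mkₐ k (Ia n m a)) =
      (Ideal.Quotient.mkₐ k (Ia n m a)).comp (phiA n m a) := by
    apply MvPolynomial.algHom_ext
    intro s
    rcases s with s | s
    · refine Fin.cases ?_ (fun t => ?_) s
      · simp [phiA]
      · simp only [phiA, AlgHom.comp_apply, aeval_X, Sum.elim_inl, Fin.cases_succ,
          Ideal.Quotient.mkₐ_eq_mk]
        symm
        rw [Ideal.Quotient.mk_eq_mk_iff_sub_mem]
        exact Ideal.subset_span ⟨t, rfl⟩
    · simp [phiA]
  exact DFunLike.congr_fun h f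

lemma phiA_eq (a : Fin n → k) (f : Cox k n m) (i j : ℕ) (hf : f ∈ bigradedPiece k n m i j) :
    phiA n m a f = X (Sum.inl 0) ^ i * psiA n m a f := by
  rw [bigradedPiece, mem_weightedHomogeneousSubmodule] at hf
  conv_lhs => rw [f.as_sum]
  conv_rhs => rw [f.as_sum]
  rw [map_sum, map_sum, Finset.mul_sum]
  refine Finset.sum_congr rfl fun d hd => ?_
  have hw := congrArg Prod.fst (hf (mem_support_iff.mp hd))
  rw [Finsupp.weight_apply, Finsupp.sum_fintype _ _ (by simp)] at hw
  simp only [biweight, Fintype.sum_sum_type, Sum.elim_inl, Sum.elim_inr, Prod.fst_add,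
    Prod.fst_sum, Prod.smul_fst, smul_eq_mul, mul_one, mul_zero, Finset.sum_const_zero,
    add_zero] at hw
  rw [phiA, psiA, aeval_monomial, aeval_monomial, Finsupp.prod_fintype _ _ (by simp),
    Finsupp.prod_fintype _ _ (by simp)]
  simp only [Fintype.prod_sum_type, Sum.elim_inl, Sum.elim_inr, Fin.prod_univ_succ (n := n),
    Fin.cases_zero, Fin.cases_succ, mul_pow, Finset.prod_mul_distrib, Finset.prod_pow_eq_pow_sum]
  rw [← hw, Fin.sum_univ_succ]
  simp only [one_pow, pow_add]
  ring

lemma psiA_Ia (a : Fin n → k) : (Ia n m a) ≤ (⊥ : Ideal _).comap (psiA n m a) := by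
  rw [Ia, Ideal.span_le]
  rintro _ ⟨t, rfl⟩
  simp [psiA, ← algebraMap_eq]

lemma psiA_Ib (a : Fin n → k) (b : Fin m → k) : (Ib n m b) ≤ (Ib n m b).comap (psiA n m a) := by
  conv_lhs => rw [Ib]
  rw [Ideal.span_le]
  rintro _ ⟨t, rfl⟩
  have : psiA n m a (C (b t) * X (Sum.inr 0) - X (Sum.inr t.succ)) =
    C (b t) * X (Sum.inr 0) - X (Sum.inr t.succ) := by
    simp [psiA, ← algebraMap_eq]
  simp only [SetLike.mem_coe, Ideal.mem_comap]
  rw [this]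
  exact Ideal.subset_span ⟨t, rfl⟩

lemma exists_lin (a b : Fin n → k) (h : a ≠ b) :
    ∃ L : Cox k n m, L ∈ Ia n m b ∧ phiA n m a L = X (Sum.inl 0) := by
  obtain ⟨t, ht⟩ := Function.ne_iff.mp h
  refine ⟨C (b t - a t)⁻¹ * (C (b t) * X (Sum.inl 0) - X (Sum.inl t.succ)),
    Ideal.mul_mem_left _ _ (Ideal.subset_span ⟨t, rfl⟩), ?_⟩
  have h2 : b t - a t ≠ 0 := sub_ne_zero.mpr (Ne.symm ht)
  have : phiA n m a (C (b t - a t)⁻¹ * (C (b t) * X (Sum.inl 0) - X (Sum.inl t.succ))) =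
      C (b t - a t)⁻¹ * (C (b t) * X (Sum.inl 0) - C (a t) * X (Sum.inl 0)) := by
    simp [phiA, ← algebraMap_eq]
  rw [this, ← sub_mul, ← C_sub, ← mul_assoc, ← C_mul, inv_mul_cancel₀ h2, C_1, one_mul]

lemma exists_lagrange {ℓ : ℕ} (P : Fin ℓ → Fin n → k) (hP : Function.Injective P) (a : Fin ℓ) :
    ∃ L : Cox k n m, (∀ b, b ≠ a → L ∈ Ia n m (P b)) ∧
      X (Sum.inl 0) ^ (ℓ - 1) - L ∈ Ia n m (P a) := by
  have h : ∀ b, ∃ L : Cox k n m, b ≠ a →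
      L ∈ Ia n m (P b) ∧ phiA n m (P a) L = X (Sum.inl 0) := by
    intro b
    by_cases hb : b = a
    · exact ⟨0, fun h => absurd hb h⟩
    · obtain ⟨L, hL⟩ := exists_lin (m := m) (P a) (P b) (fun h => hb (hP h).symm)
      exact ⟨L, fun _ => hL⟩
  choose L hL using h
  refine ⟨∏ b ∈ Finset.univ.erase a, L b, fun b hb => ?_, ?_⟩
  · exact Ideal.mem_of_dvd _ (Finset.dvd_prod_of_mem L (by simp [hb])) (hL b hb).1
  · have := sub_phiA_mem (P a) (∏ b ∈ Finset.univ.erase a, L b)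
    rw [map_prod, Finset.prod_congr rfl (fun b hb => (hL b (Finset.ne_of_mem_erase hb)).2)] at this
    rw [← neg_sub]
    simpa using neg_mem this

/-- **Lemma 2.5**: if `i ≥ ℓ - 1`, then for all `j ≥ 0` there is an equality of
bigraded pieces `(⋂_{a=1}^{ℓ} (I_{X_a} + ⟨y_0⟩)) ∩ S_{(i,j)} = (I_X + ⟨y_0⟩) ∩ S_{(i,j)}`
as `k`-subspaces of `S_{(i,j)}`. -/
theorem stmt3 (k : Type*) [Field k] [IsAlgClosed k] (n m : ℕ) (hn : 1 ≤ n) (hm : 1 ≤ m)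
    (ℓ : ℕ) (hℓ : 1 ≤ ℓ)
    (P : Fin ℓ → Fin n → k) (hP : Function.Injective P)
    (r : Fin ℓ → ℕ) (hr : ∀ a, 1 ≤ r a)
    (Q : (a : Fin ℓ) → Fin (r a) → Fin m → k)
    (hQ : ∀ a, Function.Injective (Q a))
    (i j : ℕ) (hi : ℓ - 1 ≤ i) :
    Submodule.restrictScalars k
        (⨅ a : Fin ℓ, (IXk n m P r Q a + Ideal.span {(X (Sum.inr 0) : Cox k n m)})) ⊓
      bigradedPiece k n m i j =
    Submodule.restrictScalars k
        ((⨅ a : Fin ℓ, IXk n m P r Q a) + Ideal.span {(X (Sum.inr 0) : Cox k n m)}) ⊓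
      bigradedPiece k n m i j := by
  apply le_antisymm
  · rintro f ⟨hf, hfd⟩
    refine ⟨?_, hfd⟩
    have hf : ∀ a, f ∈ IXk n m P r Q a + Ideal.span {(X (Sum.inr 0) : Cox k n m)} := by
      exact (Ideal.mem_iInf).mp ((Submodule.restrictScalars_mem k _ _).mp hf)
    have hF : ∀ a, ∃ G H : Cox k n m, G ∈ (⨅ j : Fin (r a), Ib n m (Q a j)) ∧
        psiA n m (P a) f = G + H * X (Sum.inr 0) := by
      intro a
      obtain ⟨g, hg, h, hh, rfl⟩ := Submodule.mem_sup.mp (hf a)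
      obtain ⟨u, hu, v, hv, rfl⟩ := Submodule.mem_sup.mp hg
      obtain ⟨w, rfl⟩ := Ideal.mem_span_singleton'.mp hh
      refine ⟨psiA n m (P a) v, psiA n m (P a) w, ?_, ?_⟩
      · rw [Ideal.mem_iInf] at hv ⊢
        exact fun j => psiA_Ib (P a) _ (hv j)
      · have hu0 : psiA n m (P a) u = 0 := psiA_Ia (P a) hu
        have hX : psiA n m (P a) (X (Sum.inr 0)) = X (Sum.inr 0) := by simp [psiA]
        rw [map_add, map_add, map_mul, hu0, hX, zero_add]
    choose G H hG hGH using hF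
    choose L hL hL' using exists_lagrange (m := m) P hP
    set M : Cox k n m := X (Sum.inl 0) ^ (i - (ℓ - 1)) with hM
    have hMi : M * X (Sum.inl 0) ^ (ℓ - 1) = X (Sum.inl 0) ^ i := by
      rw [hM, ← pow_add, Nat.sub_add_cancel hi]
    refine Submodule.mem_sup.mpr ⟨(∑ a, L a * M * G a) +
      (f - ∑ a, L a * M * psiA n m (P a) f), ?_, ∑ a, L a * M * (H a * X (Sum.inr 0)), ?_, ?_⟩
    · rw [Ideal.mem_iInf]
      intro b
      have hle : Ia n m (P b) ≤ IXk n m P r Q b := le_sup_left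
      refine add_mem (sum_mem fun a _ => ?_) (hle ?_)
      · by_cases hab : b = a
        · subst hab
          exact Ideal.mul_mem_left _ _ ((le_sup_right : _ ≤ IXk n m P r Q b) (hG b))
        · exact hle (Ideal.mul_mem_right _ _ (Ideal.mul_mem_right _ _ (hL a b hab)))
      · rw [← Finset.add_sum_erase _ _ (Finset.mem_univ b)]
        have h1 := sub_phiA_mem (P b) f
        rw [phiA_eq (P b) f i j hfd, ← hMi] at h1
        have h2 := Ideal.mul_mem_right (M * psiA n m (P b) f) _ (hL' b)
        have h3 : ∑ a ∈ Finset.univ.erase b, L a * M * psiA n m (P a) f ∈ Ia n m (P b) :=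
          sum_mem fun a ha => Ideal.mul_mem_right _ _
            (Ideal.mul_mem_right _ _ (hL a b (Finset.ne_of_mem_erase ha).symm))
        have h4 := sub_mem (add_mem h1 h2) h3
        convert h4 using 1
        ring
    · exact sum_mem fun a _ => Ideal.mul_mem_left _ _ (Ideal.mul_mem_left _ _
        (Ideal.subset_span rfl))
    · have : ∑ a, L a * M * psiA n m (P a) f =
          ∑ a, L a * M * G a + ∑ a, L a * M * (H a * X (Sum.inr 0)) := by
        rw [← Finset.sum_add_distrib]
        exact Finset.sum_congr rfl fun a _ => by rw [hGH a, mul_add]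
      rw [this]
      ring
  · refine inf_le_inf_right _ ?_
    intro f hf
    have : ((⨅ a : Fin ℓ, IXk n m P r Q a) + Ideal.span {(X (Sum.inr 0) : Cox k n m)}) ≤
      ⨅ a : Fin ℓ, (IXk n m P r Q a + Ideal.span {(X (Sum.inr 0) : Cox k n m)}) :=
      le_iInf fun a => sup_le_sup_right (iInf_le _ a) _
    exact this hf
end
end

section
/- Suppose X has a generic Hilbert matrix and set d = min{ r ∈ ℕ : C(r+n,n) ≥ |X| }. Then for all i ≥ d and all j ≥ 0, (⋂_{k=1}^{ℓ} (I_{X_k} + ⟨y_0⟩)) ∩ S_{(i,j)} = (I_X + ⟨y_0⟩) ∩ S_{(i,j)} (as k-subspaces of S_{(i,j)}). -/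
open MvPolynomial

noncomputable section

variable {k : Type*} [Field k] {n m : ℕ}

/-- The Hilbert function `H_{S/I}(i,j) = dim_k S_{(i,j)} - dim_k (I ∩ S_{(i,j)})`. -/
def hilbertFn (I : Ideal (Cox k n m)) (i j : ℕ) : ℕ :=
  Module.finrank k (bigradedPiece k n m i j) -
    Module.finrank k
      ((Submodule.restrictScalars k I ⊓ bigradedPiece k n m i j : Submodule k (Cox k n m)))

def ptv (p : Fin n → k) (q : Fin m → k) : Fin (n + 1) ⊕ Fin (m + 1) → k :=
  Sum.elim (Fin.cons 1 p) (Fin.cons 1 q)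

lemma weight_comp (e : (Fin (n + 1) ⊕ Fin (m + 1)) →₀ ℕ) (i j : ℕ)
    (h : Finsupp.weight (biweight n m) e = (i, j)) :
    (∑ s, e (Sum.inl s) = i) ∧ (∑ s, e (Sum.inr s) = j) := by
  rw [Finsupp.weight_apply, Finsupp.sum_fintype _ _ (by simp), Fintype.sum_sum_type] at h
  have h1 := congrArg Prod.fst h
  have h2 := congrArg Prod.snd h
  simp [biweight, Prod.fst_sum, Prod.snd_sum] at h1 h2
  exact ⟨h1, h2⟩

lemma key (J : Ideal (Cox k n m)) (p : Fin n → k) (q : Fin m → k) (i j : ℕ)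
    (h1 : Ia n m p ≤ J) (h2 : j = 0 ∨ Ib n m q ≤ J) (f : Cox k n m)
    (hf : f ∈ bigradedPiece k n m i j) :
    f - C (eval (ptv p q) f) * (X (Sum.inl 0) ^ i * X (Sum.inr 0) ^ j) ∈ J := by
  rw [← Ideal.Quotient.mk_eq_mk_iff_sub_mem]
  have hx : ∀ s : Fin (n + 1), Ideal.Quotient.mk J (X (Sum.inl s)) =
      Ideal.Quotient.mk J (C (ptv p q (Sum.inl s)) * X (Sum.inl 0)) := by
    intro s
    refine Fin.cases ?_ (fun t => ?_) s
    · simp [ptv]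
    · symm
      rw [Ideal.Quotient.mk_eq_mk_iff_sub_mem]
      apply h1
      apply Ideal.subset_span
      exact ⟨t, by simp [ptv]⟩
  have hy : j = 0 ∨ ∀ s : Fin (m + 1), Ideal.Quotient.mk J (X (Sum.inr s)) =
      Ideal.Quotient.mk J (C (ptv p q (Sum.inr s)) * X (Sum.inr 0)) := by
    refine h2.imp id (fun h2 s => ?_)
    refine Fin.cases ?_ (fun t => ?_) s
    · simp [ptv]
    · symm
      rw [Ideal.Quotient.mk_eq_mk_iff_sub_mem]
      apply h2
      apply Ideal.subset_span
      exact ⟨t, by simp [ptv]⟩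
  have hf' : IsWeightedHomogeneous (biweight n m) f (i, j) := hf
  conv_lhs => rw [f.as_sum]
  rw [eval_eq', map_sum, map_sum, Finset.sum_mul, map_sum]
  refine Finset.sum_congr rfl fun e he => ?_
  obtain ⟨ei, ej⟩ := weight_comp e i j (hf' (mem_support_iff.1 he))
  rw [monomial_eq, Finsupp.prod_fintype _ _ (by simp), Fintype.prod_sum_type,
    Fintype.prod_sum_type]
  have ex : Ideal.Quotient.mk J (∏ s : Fin (n + 1), X (Sum.inl s) ^ e (Sum.inl s)) =
      Ideal.Quotient.mk J (C (∏ s, ptv p q (Sum.inl s) ^ e (Sum.inl s)) * X (Sum.inl 0) ^ i) := by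
    rw [← ei, ← Finset.prod_pow_eq_pow_sum, map_prod C, ← Finset.prod_mul_distrib, map_prod,
      map_prod]
    refine Finset.prod_congr rfl fun s _ => ?_
    rw [map_pow, hx, ← map_pow, mul_pow, C_pow]
  have ey : Ideal.Quotient.mk J (∏ s : Fin (m + 1), X (Sum.inr s) ^ e (Sum.inr s)) =
      Ideal.Quotient.mk J (C (∏ s, ptv p q (Sum.inr s) ^ e (Sum.inr s)) * X (Sum.inr 0) ^ j) := by
    rcases hy with hj | hy
    · rw [hj] at ej ⊢
      have : ∀ s, e (Sum.inr s) = 0 := by simpa using ej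
      simp [this]
    rw [← ej, ← Finset.prod_pow_eq_pow_sum, map_prod C, ← Finset.prod_mul_distrib, map_prod,
      map_prod]
    refine Finset.prod_congr rfl fun s _ => ?_
    rw [map_pow, hy, ← map_pow, mul_pow, C_pow]
  rw [map_mul, map_mul (Ideal.Quotient.mk J) (∏ s : Fin (n + 1), _), ex, ey, ← map_mul, ← map_mul]
  congr 1
  rw [C_mul, C_mul]
  ring

set_option maxHeartbeats 1000000 in
/-- **Corollary 2.6**: if `X` has a generic Hilbert matrix and
`d = min{ r : C(r+n,n) ≥ |X| }`, then for all `i ≥ d` and all `j ≥ 0`,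
`(⋂_{a=1}^{ℓ} (I_{X_a} + ⟨y_0⟩)) ∩ S_{(i,j)} = (I_X + ⟨y_0⟩) ∩ S_{(i,j)}`. -/
theorem stmt4 (k : Type*) [Field k] [IsAlgClosed k] (n m : ℕ) (hn : 1 ≤ n) (hm : 1 ≤ m)
    (ℓ : ℕ) (hℓ : 1 ≤ ℓ)
    (P : Fin ℓ → Fin n → k) (hP : Function.Injective P)
    (r : Fin ℓ → ℕ) (hr : ∀ a, 1 ≤ r a)
    (Q : (a : Fin ℓ) → Fin (r a) → Fin m → k)
    (hQ : ∀ a, Function.Injective (Q a))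
    (N : ℕ) (hN : N = ∑ a : Fin ℓ, r a)
    (hGeneric : ∀ i j : ℕ,
      hilbertFn (⨅ a : Fin ℓ, IXk n m P r Q a) i j =
        min N ((i + n).choose n * (j + m).choose m))
    (d : ℕ) (hd : N ≤ (d + n).choose n)
    (hdmin : ∀ e : ℕ, N ≤ (e + n).choose n → d ≤ e)
    (i j : ℕ) (hi : d ≤ i) :
    Submodule.restrictScalars k
        (⨅ a : Fin ℓ, (IXk n m P r Q a + Ideal.span {(X (Sum.inr 0) : Cox k n m)})) ⊓
      bigradedPiece k n m i j =
    Submodule.restrictScalars k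
        ((⨅ a : Fin ℓ, IXk n m P r Q a) + Ideal.span {(X (Sum.inr 0) : Cox k n m)}) ⊓
      bigradedPiece k n m i j := by
  have hdi : N ≤ (i + n).choose n := hd.trans (Nat.choose_le_choose n (by omega))
  have hlN : ℓ ≤ N := by
    rw [hN]
    calc ℓ = ∑ a : Fin ℓ, 1 := by simp
      _ ≤ _ := Finset.sum_le_sum fun a _ => hr a
  have hH := hGeneric i 0
  simp only [zero_add, Nat.choose_self, mul_one, min_eq_left hdi, hilbertFn] at hH
  set I := ⨅ a : Fin ℓ, IXk n m P r Q a with hI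
  let v : Fin ℓ → (Fin (n + 1) ⊕ Fin (m + 1) → k) := fun a => ptv (P a) (Q a ⟨0, hr a⟩)
  let E : Cox k n m →ₗ[k] (Fin ℓ → k) := LinearMap.pi fun a => (aeval (v a)).toLinearMap
  have hE : ∀ f a, E f a = eval (v a) f := fun f a => by simp [E, aeval_eq_eval]
  let V := bigradedPiece k n m i 0
  let φ : V →ₗ[k] (Fin ℓ → k) := E.domRestrict V
  have hker0 : ∀ f ∈ V, E f = 0 → f ∈ I := by
    intro f hf h0
    rw [hI, Ideal.mem_iInf]
    intro a
    have := key (IXk n m P r Q a) (P a) (Q a ⟨0, hr a⟩) i 0 le_sup_left (Or.inl rfl) f hf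
    have h1 : eval (ptv (P a) (Q a ⟨0, hr a⟩)) f = 0 := by
      change eval (v a) f = 0
      rw [← hE, h0]; rfl
    simpa only [h1, map_zero, zero_mul, sub_zero] using this
  have hfin : Module.Finite k V := by
    apply Module.finite_of_finrank_pos
    change 0 < Module.finrank k (bigradedPiece k n m i 0)
    omega
  have hrn := LinearMap.finrank_range_add_finrank_ker φ
  have hkle : Module.finrank k (LinearMap.ker φ) ≤
      Module.finrank k ((Submodule.restrictScalars k I ⊓ V : Submodule k (Cox k n m))) := by
    have : Module.Finite k ((Submodule.restrictScalars k I ⊓ V : Submodule k (Cox k n m))) :=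
      Submodule.finiteDimensional_of_le (S₂ := V) inf_le_right
    rw [← Submodule.finrank_map_subtype_eq V (LinearMap.ker φ)]
    apply Submodule.finrank_mono
    rintro _ ⟨f, hf, rfl⟩
    exact ⟨hker0 f f.2 hf, f.2⟩
  have hrle : Module.finrank k (LinearMap.range φ) ≤ ℓ := by
    simpa using Submodule.finrank_le (LinearMap.range φ)
  have hVV : Module.finrank k V = Module.finrank k (bigradedPiece k n m i 0) := rfl
  change Module.finrank k V - Module.finrank k
    ((Submodule.restrictScalars k I ⊓ V : Submodule k (Cox k n m))) = N at hH
  have hNl : N = ℓ := by omega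
  have hsurj : LinearMap.range φ = ⊤ := by
    apply Submodule.eq_top_of_finrank_eq
    rw [Module.finrank_fin_fun]
    omega
  have hr1 : ∀ a, r a = 1 := by
    by_contra! hcon
    obtain ⟨a, ha⟩ := hcon
    have : ∑ a : Fin ℓ, 1 < ∑ a : Fin ℓ, r a :=
      Finset.sum_lt_sum (fun a _ => hr a) ⟨a, Finset.mem_univ _, lt_of_le_of_ne (hr a) (Ne.symm ha)⟩
    simp at this
    omega
  apply le_antisymm
  · rintro f ⟨hf, hfV⟩
    refine ⟨?_, hfV⟩
    change f ∈ I + _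
    rcases Nat.eq_zero_or_pos j with rfl | hj
    · apply Ideal.mem_sup_left
      apply hker0 f hfV
      ext a
      rw [hE]
      have hfa : f ∈ IXk n m P r Q a + Ideal.span {(X (Sum.inr 0) : Cox k n m)} :=
        (Ideal.mem_iInf.1 hf) a
      let w : Fin (n + 1) ⊕ Fin (m + 1) → k := Sum.elim (Fin.cons 1 (P a)) 0
      have hIa : Ia n m (P a) ≤ RingHom.ker (eval w) := by
        refine Ideal.span_le.2 ?_
        rintro _ ⟨t, rfl⟩
        simp [w]
      have hle : IXk n m P r Q a + Ideal.span {(X (Sum.inr 0) : Cox k n m)} ≤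
          RingHom.ker (eval w) := by
        refine sup_le (sup_le hIa ?_) ?_
        · refine (iInf_le _ ⟨0, hr a⟩).trans (Ideal.span_le.2 ?_)
          rintro _ ⟨t, rfl⟩
          simp [w]
        · refine Ideal.span_le.2 ?_
          rintro _ rfl
          simp [w]
      have h1 : eval w f = 0 := hle hfa
      have h2 := hIa (key _ (P a) (Q a ⟨0, hr a⟩) i 0 le_rfl (Or.inl rfl) f hfV)
      rw [RingHom.mem_ker] at h2
      simp [h1] at h2
      simpa [w, v] using h2
    · have hg : E f ∈ LinearMap.range φ := hsurj ▸ Submodule.mem_top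
      obtain ⟨g, hg⟩ := hg
      have hg' : E g = E f := hg
      have hgV : IsWeightedHomogeneous (biweight n m) (g : Cox k n m) (i, 0) := g.2
      have hgy : (g : Cox k n m) * X (Sum.inr 0) ^ j ∈ bigradedPiece k n m i j := by
        have := hgV.mul ((isWeightedHomogeneous_X k (biweight n m) (Sum.inr 0)).pow j)
        have hw : (i, 0) + j • biweight n m (Sum.inr 0) = (i, j) := by simp [biweight]
        rw [hw] at this
        exact this
      have hmem : f - (g : Cox k n m) * X (Sum.inr 0) ^ j ∈ I := by
        rw [hI, Ideal.mem_iInf]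
        intro a
        have hQle : Ib n m (Q a ⟨0, hr a⟩) ≤ IXk n m P r Q a := by
          refine le_trans (le_iInf fun t => ?_) le_sup_right
          have : t = ⟨0, hr a⟩ := by
            ext
            have := t.2
            have := hr1 a
            simp
            omega
          rw [this]
        have := key (IXk n m P r Q a) (P a) (Q a ⟨0, hr a⟩) i j le_sup_left (Or.inr hQle) _
          (Submodule.sub_mem _ hfV hgy)
        have h0 : eval (ptv (P a) (Q a ⟨0, hr a⟩)) (f - (g : Cox k n m) * X (Sum.inr 0) ^ j) = 0 := by
          have h3 := congrFun hg' a
          rw [hE, hE] at h3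
          simp only [v] at h3
          rw [map_sub, map_mul, h3]
          simp [ptv]
        simpa only [h0, map_zero, zero_mul, sub_zero] using this
      rw [← sub_add_cancel f ((g : Cox k n m) * X (Sum.inr 0) ^ j)]
      have hX : (X (Sum.inr 0) : Cox k n m) ∈ Ideal.span {(X (Sum.inr 0) : Cox k n m)} :=
        Ideal.mem_span_singleton_self _
      have hXj := Ideal.pow_mem_of_mem _ hX j hj
      exact Submodule.add_mem_sup hmem (Ideal.mul_mem_left _ (g : Cox k n m) hXj)
  · refine inf_le_inf_right _ ?_
    intro f hf
    change f ∈ I + _ at hf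
    change f ∈ (⨅ a, _ : Ideal (Cox k n m))
    refine (le_iInf fun a => ?_ : I + _ ≤ _) hf
    exact sup_le_sup_right (iInf_le _ a) _
end
end

section
/- For every integer t ≥ ℓ − 1, there is an equality of ideals of S: (I_X ∩ ⟨x⟩^t) + ⟨y_0⟩ = (⋂_{k=1}^{ℓ} (I_{X_k} + ⟨y_0⟩)) ∩ (⟨x⟩^t + ⟨y_0⟩). -/
open MvPolynomial

noncomputable section

variable {k : Type*} [Field k] {n m : ℕ}

theorem sub_aeval_mem {σ : Type*} {k : Type*} [Field k] (I : Ideal (MvPolynomial σ k))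
    (g : σ → MvPolynomial σ k) (h : ∀ s, X s - g s ∈ I) (f : MvPolynomial σ k) :
    f - aeval g f ∈ I := by
  rw [← Ideal.Quotient.mk_eq_mk_iff_sub_mem]
  have : (Ideal.Quotient.mkₐ k I) = (Ideal.Quotient.mkₐ k I).comp (aeval g) := by
    apply MvPolynomial.algHom_ext
    intro s
    simp only [AlgHom.comp_apply, aeval_X, Ideal.Quotient.mkₐ_eq_mk]
    rw [Ideal.Quotient.mk_eq_mk_iff_sub_mem]
    exact h s
  exact DFunLike.congr_fun this f

/-- substitute `x_i ↦ a_i x_0`. -/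
def phiG (n m : ℕ) (a : Fin n → k) : Fin (n + 1) ⊕ Fin (m + 1) → Cox k n m :=
  Sum.elim (Fin.cases (X (Sum.inl 0)) (fun i => C (a i) * X (Sum.inl 0))) (fun j => X (Sum.inr j))

def phi (n m : ℕ) (a : Fin n → k) : Cox k n m →ₐ[k] Cox k n m := aeval (phiG n m a)

/-- substitute `y_j ↦ b_j y_0`. -/
def thG (n m : ℕ) (b : Fin m → k) : Fin (n + 1) ⊕ Fin (m + 1) → Cox k n m :=
  Sum.elim (fun j => X (Sum.inl j)) (Fin.cases (X (Sum.inr 0)) (fun i => C (b i) * X (Sum.inr 0)))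

def th (n m : ℕ) (b : Fin m → k) : Cox k n m →ₐ[k] Cox k n m := aeval (thG n m b)

/-- substitute `x_0 ↦ 0`. -/
def psiG (k : Type*) [Field k] (n m : ℕ) : Fin (n + 1) ⊕ Fin (m + 1) → Cox k n m :=
  Sum.elim (Fin.cases 0 (fun i => X (Sum.inl i.succ))) (fun j => X (Sum.inr j))

def psi (k : Type*) [Field k] (n m : ℕ) : Cox k n m →ₐ[k] Cox k n m := aeval (psiG k n m)

@[simp] theorem phi_x0 (a : Fin n → k) : phi n m a (X (Sum.inl 0)) = X (Sum.inl 0) := by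
  simp [phi, phiG]
@[simp] theorem phi_xs (a : Fin n → k) (i : Fin n) :
    phi n m a (X (Sum.inl i.succ)) = C (a i) * X (Sum.inl 0) := by
  simp [phi, phiG]
@[simp] theorem phi_y (a : Fin n → k) (j : Fin (m+1)) :
    phi n m a (X (Sum.inr j)) = X (Sum.inr j) := by
  simp [phi, phiG]
@[simp] theorem phi_C (a : Fin n → k) (c : k) : phi n m a (C c) = C c := by
  simp [phi]
@[simp] theorem th_y0 (a : Fin m → k) : th n m a (X (Sum.inr 0)) = X (Sum.inr 0) := by
  simp [th, thG]
@[simp] theorem th_ys (a : Fin m → k) (i : Fin m) :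
    th n m a (X (Sum.inr i.succ)) = C (a i) * X (Sum.inr 0) := by
  simp [th, thG]
@[simp] theorem th_x (a : Fin m → k) (j : Fin (n+1)) :
    th n m a (X (Sum.inl j)) = X (Sum.inl j) := by
  simp [th, thG]
@[simp] theorem th_C (a : Fin m → k) (c : k) : th n m a (C c) = C c := by
  simp [th]
@[simp] theorem psi_x0 : psi k n m (X (Sum.inl 0)) = 0 := by
  simp [psi, psiG]
@[simp] theorem psi_y (j : Fin (m+1)) :
    psi k n m (X (Sum.inr j)) = X (Sum.inr j) := by
  simp [psi, psiG]
@[simp] theorem psi_C (c : k) : psi k n m (C c) = C c := by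
  simp [psi]

theorem sub_phi_mem (a : Fin n → k) (f : Cox k n m) : f - phi n m a f ∈ Ia n m a := by
  apply sub_aeval_mem
  rintro (s | s)
  · refine Fin.cases ?_ (fun i => ?_) s
    · simp [phiG]
    · rw [← neg_mem_iff]
      simp only [phiG, Sum.elim_inl, Fin.cases_succ, neg_sub]
      exact Ideal.subset_span ⟨i, rfl⟩
  · simp [phiG]

theorem sub_th_mem (a : Fin m → k) (f : Cox k n m) : f - th n m a f ∈ Ib n m a := by
  apply sub_aeval_mem
  rintro (s | s)
  · simp [thG]
  · refine Fin.cases ?_ (fun i => ?_) s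
    · simp [thG]
    · rw [← neg_mem_iff]
      simp only [thG, Sum.elim_inr, Fin.cases_succ, neg_sub]
      exact Ideal.subset_span ⟨i, rfl⟩

theorem sub_psi_mem (f : Cox k n m) : f - psi k n m f ∈ Ideal.span {(X (Sum.inl 0) : Cox k n m)} := by
  apply sub_aeval_mem
  rintro (s | s)
  · refine Fin.cases ?_ (fun i => ?_) s
    · simpa [psiG] using Ideal.mem_span_singleton_self _
    · simp [psiG]
  · simp [psiG]

theorem phi_Ia (a : Fin n → k) (f : Cox k n m) (hf : f ∈ Ia n m a) : phi n m a f = 0 := by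
  have : Ia n m a ≤ RingHom.ker (phi n m a) := by
    rw [Ia, Ideal.span_le]
    rintro _ ⟨i, rfl⟩
    simp [RingHom.mem_ker]
  exact this hf

theorem mem_Ib_iff (b : Fin m → k) (f : Cox k n m) : f ∈ Ib n m b ↔ th n m b f = 0 := by
  constructor
  · intro hf
    have : Ib n m b ≤ RingHom.ker (th n m b) := by
      rw [Ib, Ideal.span_le]
      rintro _ ⟨i, rfl⟩
      simp [RingHom.mem_ker]
    exact this hf
  · intro h
    have := sub_th_mem b f
    rwa [h, sub_zero] at this

theorem phi_Ib (a : Fin n → k) (b : Fin m → k) (f : Cox k n m) (hf : f ∈ Ib n m b) :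
    phi n m a f ∈ Ib n m b := by
  have : Ib n m b ≤ (Ib n m b).comap (phi n m a) := by
    conv_lhs => rw [Ib]
    rw [Ideal.span_le]
    rintro _ ⟨i, rfl⟩
    simp only [SetLike.mem_coe, Ideal.mem_comap, map_sub, map_mul, phi_C, phi_y]
    exact Ideal.subset_span ⟨i, rfl⟩
  exact this hf

theorem psi_Ib (b : Fin m → k) (f : Cox k n m) (hf : f ∈ Ib n m b) :
    psi k n m f ∈ Ib n m b := by
  have : Ib n m b ≤ (Ib n m b).comap (psi k n m) := by
    conv_lhs => rw [Ib]
    rw [Ideal.span_le]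
    rintro _ ⟨i, rfl⟩
    simp only [SetLike.mem_coe, Ideal.mem_comap, map_sub, map_mul, psi_C, psi_y]
    exact Ideal.subset_span ⟨i, rfl⟩
  exact this hf

theorem phi_K {r : ℕ} (a : Fin n → k) (Q : Fin r → Fin m → k) (f : Cox k n m)
    (hf : f ∈ ⨅ j, Ib n m (Q j)) : phi n m a f ∈ ⨅ j, Ib n m (Q j) := by
  rw [Ideal.mem_iInf] at hf ⊢
  exact fun j => phi_Ib _ _ _ (hf j)

theorem cancel_x0 {r : ℕ} (Q : Fin r → Fin m → k) (f : Cox k n m)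
    (hf : ∃ u ∈ ⨅ j, Ib n m (Q j), ∃ v, X (Sum.inl 0) * f = u + X (Sum.inr 0) * v) :
    ∃ u ∈ ⨅ j, Ib n m (Q j), ∃ v, f = u + X (Sum.inr 0) * v := by
  obtain ⟨u, hu, v, h⟩ := hf
  obtain ⟨u', hu'⟩ := Ideal.mem_span_singleton.1 (sub_psi_mem u)
  obtain ⟨v', hv'⟩ := Ideal.mem_span_singleton.1 (sub_psi_mem v)
  have h2 := congrArg (psi k n m) h
  simp only [map_mul, map_add, psi_x0, psi_y, zero_mul] at h2
  refine ⟨u', ?_, v', ?_⟩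
  · rw [Ideal.mem_iInf] at hu ⊢
    intro j
    have h3 : X (Sum.inl 0) * u' ∈ Ib n m (Q j) := by
      rw [← hu']
      exact sub_mem (hu j) (psi_Ib _ _ (hu j))
    rw [mem_Ib_iff] at h3 ⊢
    rw [map_mul, th_x] at h3
    exact (mul_eq_zero.1 h3).resolve_left (X_ne_zero _)
  · apply mul_left_cancel₀ (X_ne_zero (R := k) (Sum.inl (0 : Fin (n+1)) : Fin (n+1) ⊕ Fin (m+1)))
    linear_combination h - h2 + hu' + X (Sum.inr 0) * hv'

theorem cancel_x0_pow {r : ℕ} (Q : Fin r → Fin m → k) (t : ℕ) : ∀ (f : Cox k n m)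
    (_ : ∃ u ∈ ⨅ j, Ib n m (Q j), ∃ v, X (Sum.inl 0) ^ t * f = u + X (Sum.inr 0) * v),
    ∃ u ∈ ⨅ j, Ib n m (Q j), ∃ v, f = u + X (Sum.inr 0) * v := by
  induction t with
  | zero => intro f hf; simpa using hf
  | succ t ih =>
    intro f hf
    apply cancel_x0
    apply ih
    simpa [pow_succ, mul_assoc] using hf

theorem phi_xIdeal_pow (a : Fin n → k) (t : ℕ) (f : Cox k n m) (hf : f ∈ xIdeal k n m ^ t) :
    ∃ g, phi n m a f = X (Sum.inl 0) ^ t * g := by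
  have h1 : (xIdeal k n m).map (phi n m a) ≤ Ideal.span {(X (Sum.inl 0) : Cox k n m)} := by
    rw [xIdeal, Ideal.map_span, Ideal.span_le]
    rintro _ ⟨_, ⟨i, rfl⟩, rfl⟩
    rw [SetLike.mem_coe, Ideal.mem_span_singleton]
    refine Fin.cases ?_ (fun i => ?_) i
    · simp
    · simp
  have h2 := Ideal.mem_map_of_mem (phi n m a) hf
  rw [Ideal.map_pow] at h2
  have h3 := Ideal.pow_right_mono h1 t h2
  rw [Ideal.span_singleton_pow, Ideal.mem_span_singleton] at h3
  exact h3

theorem exists_sep (hn : 1 ≤ n) {ℓ : ℕ} (P : Fin ℓ → Fin n → k) (hP : Function.Injective P) (a : Fin ℓ) :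
    ∃ L ∈ xIdeal k n m ^ (ℓ - 1), phi n m (P a) L = X (Sum.inl 0) ^ (ℓ - 1) ∧
      ∀ b, b ≠ a → phi n m (P b) L = 0 := by
  have h : ∀ b, ∃ i, b ≠ a → P b i ≠ P a i := by
    intro b
    by_cases hb : b = a
    · exact ⟨⟨0, hn⟩, fun h => absurd hb h⟩
    · obtain ⟨i, hi⟩ := Function.ne_iff.1 (fun h => hb (hP h))
      exact ⟨i, fun _ => hi⟩
  choose i hi using h
  have hcard : (Finset.univ.erase a).card = ℓ - 1 := by simp
  refine ⟨∏ b ∈ Finset.univ.erase a, C (P b (i b) - P a (i b))⁻¹ *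
    (C (P b (i b)) * X (Sum.inl 0) - X (Sum.inl (i b).succ)), ?_, ?_, ?_⟩
  · rw [← hcard, ← Finset.prod_const]
    apply Ideal.prod_mem_prod
    intro b _
    apply Ideal.mul_mem_left
    exact sub_mem (Ideal.mul_mem_left _ _ (Ideal.subset_span ⟨_, rfl⟩)) (Ideal.subset_span ⟨_, rfl⟩)
  · rw [map_prod, ← hcard, ← Finset.prod_const]
    apply Finset.prod_congr rfl
    intro b hb
    have := sub_ne_zero.2 (hi b (Finset.ne_of_mem_erase hb))
    simp only [map_mul, map_sub, phi_C, phi_x0, phi_xs]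
    rw [← sub_mul, ← C_sub, ← mul_assoc, ← C_mul, inv_mul_cancel₀ this, C_1, one_mul]
  · intro b hb
    rw [map_prod]
    apply Finset.prod_eq_zero (Finset.mem_erase.2 ⟨hb, Finset.mem_univ b⟩)
    simp

/-- **Proposition 2.7** (primary decomposition): for every `t ≥ ℓ - 1`,
`(I_X ∩ ⟨x⟩^t) + ⟨y_0⟩ = (⋂_{a=1}^{ℓ} (I_{X_a} + ⟨y_0⟩)) ∩ (⟨x⟩^t + ⟨y_0⟩)`. -/
theorem stmt5 (k : Type*) [Field k] [IsAlgClosed k] (n m : ℕ) (hn : 1 ≤ n) (hm : 1 ≤ m)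
    (ℓ : ℕ) (hℓ : 1 ≤ ℓ)
    (P : Fin ℓ → Fin n → k) (hP : Function.Injective P)
    (r : Fin ℓ → ℕ) (hr : ∀ a, 1 ≤ r a)
    (Q : (a : Fin ℓ) → Fin (r a) → Fin m → k)
    (hQ : ∀ a, Function.Injective (Q a))
    (t : ℕ) (ht : ℓ - 1 ≤ t) :
    ((⨅ a : Fin ℓ, IXk n m P r Q a) ⊓ xIdeal k n m ^ t) +
        Ideal.span {(X (Sum.inr 0) : Cox k n m)} =
      (⨅ a : Fin ℓ, (IXk n m P r Q a + Ideal.span {(X (Sum.inr 0) : Cox k n m)})) ⊓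
        (xIdeal k n m ^ t + Ideal.span {(X (Sum.inr 0) : Cox k n m)}) := by
  apply le_antisymm
  · refine le_inf (le_iInf fun a => ?_) ?_
    · exact sup_le_sup_right (inf_le_left.trans (iInf_le _ a)) _
    · exact sup_le_sup_right inf_le_right _
  intro F hF
  obtain ⟨hF1, hF2⟩ := Ideal.mem_inf.1 hF
  obtain ⟨f, hf, z, hz, rfl⟩ := Submodule.mem_sup.1 hF2
  have hf1 : ∀ a, f ∈ IXk n m P r Q a + Ideal.span {(X (Sum.inr 0) : Cox k n m)} := by
    intro a
    have h1 := (Ideal.mem_iInf.1 hF1) a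
    have h2 := Ideal.mem_sup_right (S := IXk n m P r Q a) hz
    simpa using sub_mem h1 h2
  have key : ∀ a, ∃ u ∈ ⨅ j, Ib n m (Q a j), ∃ v,
      phi n m (P a) f = X (Sum.inl 0) ^ t * (u + X (Sum.inr 0) * v) := by
    intro a
    obtain ⟨g, hg⟩ := phi_xIdeal_pow (P a) t f hf
    have : ∃ u ∈ ⨅ j, Ib n m (Q a j), ∃ v, g = u + X (Sum.inr 0) * v := by
      apply cancel_x0_pow (Q a) t
      obtain ⟨p, hp, w, hw, hpw⟩ := Submodule.mem_sup.1 (hf1 a)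
      obtain ⟨p1, hp1, p2, hp2, rfl⟩ := Submodule.mem_sup.1 hp
      obtain ⟨v, rfl⟩ := Ideal.mem_span_singleton.1 hw
      refine ⟨phi n m (P a) p2, phi_K _ _ _ hp2, phi n m (P a) v, ?_⟩
      rw [← hg, ← hpw]
      simp [phi_Ia _ _ hp1]
    obtain ⟨u, hu, v, rfl⟩ := this
    exact ⟨u, hu, v, hg⟩
  choose u hu v huv using key
  choose L hL hLa hLb using fun a => exists_sep (m := m) hn P hP a
  set s : Cox k n m := ∑ a, L a * X (Sum.inl 0) ^ (t - (ℓ - 1)) * v a with hs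
  have hidem : ∀ a, phi n m (P a) (phi n m (P a) f) = phi n m (P a) f := by
    intro a
    have := phi_Ia _ _ (sub_phi_mem (P a) f)
    rw [map_sub, sub_eq_zero] at this
    exact this.symm
  have hps : ∀ a, phi n m (P a) s = X (Sum.inl 0) ^ t * phi n m (P a) (v a) := by
    intro a
    rw [hs, map_sum, Finset.sum_eq_single a]
    · rw [map_mul, map_mul, hLa, map_pow, phi_x0, ← pow_add, Nat.add_sub_cancel' ht]
    · intro b _ hb
      rw [map_mul, map_mul, hLb b a hb.symm, zero_mul, zero_mul]
    · simp
  have hsx : s ∈ xIdeal k n m ^ t := by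
    refine Ideal.sum_mem _ fun a _ => Ideal.mul_mem_right _ _ ?_
    have e : xIdeal k n m ^ t = xIdeal k n m ^ (ℓ - 1) * xIdeal k n m ^ (t - (ℓ - 1)) := by
      rw [← pow_add, Nat.add_sub_cancel' ht]
    have hx : (X (Sum.inl 0) : Cox k n m) ∈ xIdeal k n m := Ideal.subset_span ⟨0, rfl⟩
    rw [e]
    exact Ideal.mul_mem_mul (hL a) (Ideal.pow_mem_pow hx _)
  have hfg : f + z = (f - X (Sum.inr 0) * s) + (X (Sum.inr 0) * s + z) := by ring
  rw [hfg]
  refine Submodule.add_mem_sup (Ideal.mem_inf.2 ⟨?_, ?_⟩) ?_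
  · rw [Ideal.mem_iInf]
    intro a
    have h1 := sub_phi_mem (P a) (f - X (Sum.inr 0) * s)
    have h2 : phi n m (P a) (f - X (Sum.inr 0) * s) ∈ ⨅ j, Ib n m (Q a j) := by
      have : phi n m (P a) (f - X (Sum.inr 0) * s) =
          X (Sum.inl 0) ^ t * phi n m (P a) (u a) := by
        rw [map_sub, map_mul, hps, ← hidem a, huv a]
        simp only [map_mul, map_add, map_pow, phi_x0, phi_y]
        ring
      rw [this]
      exact Ideal.mul_mem_left _ _ (phi_K _ _ _ (hu a))
    have h3 := Submodule.add_mem_sup h1 h2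
    rwa [sub_add_cancel] at h3
  · exact sub_mem hf (Ideal.mul_mem_left _ _ hsx)
  · exact add_mem (Ideal.mul_mem_right _ _ (Ideal.mem_span_singleton_self _)) hz
end
end

section
/- For each 1 ≤ k ≤ ℓ, the ideal I_{X_k} + ⟨y_0⟩ = I_{P_k} + ⋂_{j=1}^{r_k} I_{Q_{k,j}} + ⟨y_0⟩ is a primary ideal of S. -/
open MvPolynomial

noncomputable section

variable {k : Type*} [Field k] {n m : ℕ}

theorem aux_primary_map_C {R : Type*} [CommRing R] {K : Ideal R} (hK : K.IsPrimary) :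
    (K.map (Polynomial.C : R →+* Polynomial R)).IsPrimary := by
  have h0 : K.map (Polynomial.C : R →+* Polynomial R)
      = (⊥ : Ideal (Polynomial (R ⧸ K))).comap (Polynomial.mapRingHom (Ideal.Quotient.mk K)) := by
    ext f
    rw [Ideal.mem_map_C_iff, Ideal.mem_comap, Ideal.mem_bot, Polynomial.ext_iff]
    simp [Ideal.Quotient.eq_zero_iff_mem]
  rw [h0]
  apply Ideal.IsPrimary.comap
  rw [Ideal.isPrimary_iff] at hK ⊢
  obtain ⟨hne, hK⟩ := hK
  have : Nontrivial (R ⧸ K) := Ideal.Quotient.nontrivial_iff.mpr hne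
  refine ⟨bot_ne_top, ?_⟩
  intro f g hfg
  rw [Ideal.mem_bot] at hfg ⊢
  by_cases hf : f = 0
  · exact Or.inl hf
  right
  have hg : g ∉ nonZeroDivisors (Polynomial (R ⧸ K)) := fun hg =>
    hf ((mem_nonZeroDivisors_iff.mp hg).2 f hfg)
  obtain ⟨a, ha, hag⟩ := Polynomial.notMem_nonZeroDivisors_iff.mp hg
  change g ∈ nilradical _
  rw [mem_nilradical, Polynomial.isNilpotent_iff]
  intro i
  have hi : a * g.coeff i = 0 := by
    have := congrArg (fun p => Polynomial.coeff p i) hag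
    simpa using this
  obtain ⟨b, hb⟩ := Ideal.Quotient.mk_surjective (g.coeff i)
  obtain ⟨a', rfl⟩ := Ideal.Quotient.mk_surjective a
  rw [← hb] at hi ⊢
  rw [← map_mul, Ideal.Quotient.eq_zero_iff_mem] at hi
  rcases hK hi with h | ⟨N, h⟩
  · exact absurd (Ideal.Quotient.eq_zero_iff_mem.mpr h) (by assumption)
  · exact ⟨N, by rw [← map_pow]; exact Ideal.Quotient.eq_zero_iff_mem.mpr h⟩

/-- The ideal of a point in `k[y]`. -/
def auxIb {k : Type*} [Field k] (m : ℕ) (b : Fin m → k) : Ideal (MvPolynomial (Fin (m+1)) k) :=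
  Ideal.span (Set.range fun j : Fin m => C (b j) * X 0 - X j.succ)

theorem aux_primary_K {k : Type*} [Field k] (m r : ℕ) (hr : 1 ≤ r) (Q : Fin r → Fin m → k) :
    ((⨅ j, auxIb m (Q j)) + Ideal.span {(X 0 : MvPolynomial (Fin (m+1)) k)}).IsPrimary := by
  set K := (⨅ j, auxIb m (Q j)) + Ideal.span {(X 0 : MvPolynomial (Fin (m+1)) k)} with hKdef
  apply Ideal.isPrimary_of_isMaximal_radical
  set M := RingHom.ker (constantCoeff : MvPolynomial (Fin (m+1)) k →+* k) with hM
  have hmax : M.IsMaximal := RingHom.ker_isMaximal_of_surjective _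
    (fun c => ⟨C c, by simp⟩)
  have hKM : K ≤ M := by
    refine sup_le ?_ ?_
    · refine (iInf_le _ ⟨0, hr⟩).trans ?_
      rw [auxIb, Ideal.span_le]
      rintro _ ⟨j, rfl⟩
      simp [hM, RingHom.mem_ker]
    · rw [Ideal.span_le]
      rintro _ rfl
      simp [hM, RingHom.mem_ker]
  have hX : ∀ i, (X i : MvPolynomial (Fin (m+1)) k) ∈ K.radical := by
    intro i
    rw [Ideal.radical_eq_sInf, Ideal.mem_sInf]
    rintro p ⟨hp, hprime⟩
    have h0 : (X 0 : MvPolynomial (Fin (m+1)) k) ∈ p :=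
      hp (Ideal.mem_sup_right (Ideal.subset_span rfl))
    have h1 : (Finset.univ.inf fun j => auxIb m (Q j)) ≤ p := by
      rw [Finset.inf_univ_eq_iInf]
      exact le_sup_left.trans hp
    obtain ⟨q, -, hq⟩ := (Ideal.IsPrime.inf_le' hprime).mp h1
    refine Fin.cases h0 (fun j => ?_) i
    have h2 : (C (Q q j) * X 0 - X j.succ : MvPolynomial (Fin (m+1)) k) ∈ p :=
      hq (Ideal.subset_span ⟨j, rfl⟩)
    have := p.sub_mem (p.mul_mem_left (C (Q q j)) h0) h2
    simpa using this
  have hall : ∀ f : MvPolynomial (Fin (m+1)) k, f - C (constantCoeff f) ∈ K.radical := by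
    intro f
    induction f using MvPolynomial.induction_on with
    | C a => simp
    | add p q hp hq =>
      have := K.radical.add_mem hp hq
      rw [map_add, map_add]
      convert this using 1
      ring
    | mul_X p i hp =>
      simpa using K.radical.mul_mem_left p (hX i)
  have heq : K.radical = M := by
    apply le_antisymm
    · exact hmax.isPrime.radical_le_iff.mpr hKM
    · intro f hf
      have := hall f
      rw [hM, RingHom.mem_ker] at hf
      simpa [hf] using this
  rw [heq]
  exact hmax

/-- Substitution `x_0 ↦ T`, `x_i ↦ a_i T`, `y_j ↦ y_j`. -/
def auxPhi {k : Type*} [Field k] (n m : ℕ) (a : Fin n → k) :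
    Cox k n m →ₐ[k] Polynomial (MvPolynomial (Fin (m+1)) k) :=
  aeval (Sum.elim (Fin.cons Polynomial.X fun i => Polynomial.C (C (a i)) * Polynomial.X)
    fun j => Polynomial.C (X j))

/-- The section of `auxPhi`. -/
def auxPsi (k : Type*) [Field k] (n m : ℕ) :
    Polynomial (MvPolynomial (Fin (m+1)) k) →+* Cox k n m :=
  Polynomial.eval₂RingHom (rename Sum.inr).toRingHom (X (Sum.inl 0))

theorem aux_psi_phi {k : Type*} [Field k] (n m : ℕ) (a : Fin n → k) (f : Cox k n m) :
    f - auxPsi k n m (auxPhi n m a f) ∈ Ia n m a := by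
  induction f using MvPolynomial.induction_on with
  | C c =>
    have : (C c : Cox k n m) = algebraMap k _ c := rfl
    simp [auxPhi, auxPsi, Polynomial.algebraMap_apply, MvPolynomial.algebraMap_eq]
  | add p q hp hq =>
    have := (Ia n m a).add_mem hp hq
    rw [map_add, map_add]
    convert this using 1
    ring
  | mul_X p i hp =>
    have hXi : (X i : Cox k n m) - auxPsi k n m (auxPhi n m a (X i)) ∈ Ia n m a := by
      rcases i with i | j
      · refine Fin.cases ?_ (fun i => ?_) i
        · simp [auxPhi, auxPsi]
        · have := (Ia n m a).neg_mem (Ideal.subset_span ⟨i, rfl⟩ :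
            (C (a i) * X (Sum.inl 0) - X (Sum.inl i.succ) : Cox k n m) ∈ Ia n m a)
          simpa [auxPhi, auxPsi] using this
      · simp [auxPhi, auxPsi]
    rw [map_mul, map_mul]
    have := (Ia n m a).add_mem ((Ia n m a).mul_mem_right (X i) hp)
      ((Ia n m a).mul_mem_left (auxPsi k n m (auxPhi n m a p)) hXi)
    convert this using 1
    ring

theorem aux_comap {k : Type*} [Field k] (n m r : ℕ) (a : Fin n → k) (Q : Fin r → Fin m → k) :
    (Ia n m a + ⨅ j, Ib n m (Q j)) + Ideal.span {(X (Sum.inr 0) : Cox k n m)}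
    = (((⨅ j, auxIb m (Q j)) + Ideal.span {(X 0 : MvPolynomial (Fin (m+1)) k)}).map
      (Polynomial.C : _ →+* Polynomial (MvPolynomial (Fin (m+1)) k))).comap
      (auxPhi n m a).toRingHom := by
  apply le_antisymm
  · refine sup_le (sup_le ?_ ?_) ?_
    · rw [Ia, Ideal.span_le]
      rintro _ ⟨i, rfl⟩
      have : auxPhi n m a (C (a i) * X (Sum.inl 0) - X (Sum.inl i.succ)) = 0 := by
        simp [auxPhi, Polynomial.algebraMap_apply, MvPolynomial.algebraMap_eq]
      refine Ideal.mem_comap.mpr ?_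
      rw [show (auxPhi n m a).toRingHom _ = _ from this]
      exact zero_mem _
    · intro f hf
      refine Ideal.mem_comap.mpr ?_
      refine Ideal.map_mono le_sup_left ?_
      rw [Ideal.mem_map_C_iff]
      intro d
      rw [Ideal.mem_iInf] at hf ⊢
      intro j
      have h : Ib n m (Q j) ≤ ((auxIb m (Q j)).map
          (Polynomial.C : _ →+* Polynomial (MvPolynomial (Fin (m+1)) k))).comap
          (auxPhi n m a).toRingHom := by
        rw [Ib, Ideal.span_le]
        rintro _ ⟨i, rfl⟩
        have : auxPhi n m a (C (Q j i) * X (Sum.inr 0) - X (Sum.inr i.succ))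
            = Polynomial.C (C (Q j i) * X 0 - X i.succ) := by
          simp [auxPhi, Polynomial.algebraMap_apply, MvPolynomial.algebraMap_eq]
        refine Ideal.mem_comap.mpr ?_
        rw [show (auxPhi n m a).toRingHom _ = _ from this]
        exact Ideal.mem_map_of_mem _ (Ideal.subset_span ⟨i, rfl⟩)
      exact Ideal.mem_map_C_iff.mp (h (hf j)) d
    · rw [Ideal.span_le]
      rintro _ rfl
      have : auxPhi n m a (X (Sum.inr 0)) = Polynomial.C (X 0) := by simp [auxPhi]
      refine Ideal.mem_comap.mpr ?_
      rw [show (auxPhi n m a).toRingHom _ = _ from this]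
      exact Ideal.mem_map_of_mem _ (Ideal.mem_sup_right (Ideal.subset_span rfl))
  · intro f hf
    have h1 := aux_psi_phi n m a f
    have h2 : auxPsi k n m (auxPhi n m a f) ∈
        (⨅ j, Ib n m (Q j)) + Ideal.span {(X (Sum.inr 0) : Cox k n m)} := by
      have hle : (((⨅ j, auxIb m (Q j)) + Ideal.span {(X 0 : MvPolynomial (Fin (m+1)) k)}).map
          (Polynomial.C : _ →+* Polynomial (MvPolynomial (Fin (m+1)) k))) ≤
          ((⨅ j, Ib n m (Q j)) + Ideal.span {(X (Sum.inr 0) : Cox k n m)}).comap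
            (auxPsi k n m) := by
        rw [Ideal.map_le_iff_le_comap]
        intro g hg
        refine Ideal.mem_comap.mpr (Ideal.mem_comap.mpr ?_)
        have e : auxPsi k n m (Polynomial.C g) = rename Sum.inr g := by simp [auxPsi]
        rw [e]
        suffices hs : (⨅ j, auxIb m (Q j)) + Ideal.span {(X 0 : MvPolynomial (Fin (m+1)) k)} ≤
            Ideal.comap (rename Sum.inr : _ →ₐ[k] Cox k n m)
              ((⨅ j, Ib n m (Q j)) + Ideal.span {(X (Sum.inr 0) : Cox k n m)}) from
          Ideal.mem_comap.mp (hs hg)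
        refine sup_le ?_ ?_
        · intro g hg
          refine Ideal.mem_comap.mpr (Ideal.mem_sup_left ?_)
          rw [Ideal.mem_iInf] at hg ⊢
          intro j
          have : auxIb m (Q j) ≤ (Ib n m (Q j)).comap
              (rename Sum.inr : _ →ₐ[k] Cox k n m) := by
            rw [auxIb, Ideal.span_le]
            rintro _ ⟨i, rfl⟩
            refine Ideal.mem_comap.mpr (Ideal.subset_span ⟨i, ?_⟩)
            simp
          exact this (hg j)
        · rw [Ideal.span_le]
          rintro _ rfl
          refine Ideal.mem_comap.mpr (Ideal.mem_sup_right (Ideal.subset_span ?_))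
          simp
      exact hle hf
    have h3 : f = (f - auxPsi k n m (auxPhi n m a f)) + auxPsi k n m (auxPhi n m a f) := by ring
    rw [h3, add_assoc]
    exact Submodule.add_mem_sup h1 h2

/-- **Part of Proposition 2.7**: for each `1 ≤ a ≤ ℓ`, the ideal
`I_{X_a} + ⟨y_0⟩ = I_{P_a} + ⋂_{j=1}^{r_a} I_{Q_{a,j}} + ⟨y_0⟩` is a primary
ideal of `S`. -/
theorem stmt6 (k : Type*) [Field k] [IsAlgClosed k] (n m : ℕ) (hn : 1 ≤ n) (hm : 1 ≤ m)
    (ℓ : ℕ) (hℓ : 1 ≤ ℓ)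
    (P : Fin ℓ → Fin n → k) (hP : Function.Injective P)
    (r : Fin ℓ → ℕ) (hr : ∀ a, 1 ≤ r a)
    (Q : (a : Fin ℓ) → Fin (r a) → Fin m → k)
    (hQ : ∀ a, Function.Injective (Q a))
    (a : Fin ℓ) :
    (IXk n m P r Q a + Ideal.span {(X (Sum.inr 0) : Cox k n m)}).IsPrimary := by
  rw [IXk, aux_comap]
  exact (aux_primary_map_C (aux_primary_K m (r a) (hr a) (Q a))).comap _
end
end

section
/- Let B = ⟨x_0,…,x_n⟩ ∩ ⟨y_0,…,y_m⟩ be the irrelevant ideal and let t ≥ 0 be an integer. Then the B-saturation of I_X ∩ ⟨x⟩^t equals I_X; that is, for every f ∈ S, f ∈ I_X if and only if there exists s ∈ ℕ with f·B^s ⊆ I_X ∩ ⟨x⟩^t. -/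
open MvPolynomial

noncomputable section

variable {k : Type*} [Field k] {n m : ℕ}

/-- The ideal `⟨y_0, …, y_m⟩`. -/
def yIdeal (k : Type*) [Field k] (n m : ℕ) : Ideal (Cox k n m) :=
  Ideal.span (Set.range fun j : Fin (m + 1) => (X (Sum.inr j) : Cox k n m))

lemma sub_aeval_mem_s9 (I : Ideal (Cox k n m)) (v : Fin (n + 1) ⊕ Fin (m + 1) → Cox k n m)
    (h : ∀ i, X i - v i ∈ I) (f : Cox k n m) : f - aeval v f ∈ I := by
  have key : (Ideal.Quotient.mkₐ k I).comp (aeval v) = Ideal.Quotient.mkₐ k I := by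
    apply MvPolynomial.algHom_ext
    intro i
    simp only [AlgHom.comp_apply, aeval_X, Ideal.Quotient.mkₐ_eq_mk]
    exact ((Ideal.Quotient.eq).2 (h i)).symm
  have := DFunLike.congr_fun key f
  simp only [AlgHom.comp_apply, Ideal.Quotient.mkₐ_eq_mk] at this
  exact (Ideal.Quotient.eq).1 this.symm

def subX (m : ℕ) (a : Fin n → k) : Fin (n + 1) ⊕ Fin (m + 1) → Cox k n m :=
  Sum.elim (Fin.cons (X (Sum.inl 0)) fun i => C (a i) * X (Sum.inl 0)) fun j => X (Sum.inr j)

def subY (n : ℕ) (b : Fin m → k) : Fin (n + 1) ⊕ Fin (m + 1) → Cox k n m :=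
  Sum.elim (fun j => X (Sum.inl j)) (Fin.cons (X (Sum.inr 0)) fun i => C (b i) * X (Sum.inr 0))

lemma subX_mem (a : Fin n → k) (f : Cox k n m) : f - aeval (subX m a) f ∈ Ia n m a := by
  apply sub_aeval_mem_s9
  rintro (i | j)
  · refine Fin.cases ?_ (fun i => ?_) i
    · simp [subX]
    · rw [← neg_mem_iff]
      exact Ideal.subset_span ⟨i, by simp [subX]⟩
  · simp [subX]

lemma subY_mem (b : Fin m → k) (f : Cox k n m) : f - aeval (subY n b) f ∈ Ib n m b := by
  apply sub_aeval_mem_s9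
  rintro (i | j)
  · simp [subY]
  · refine Fin.cases ?_ (fun i => ?_) j
    · simp [subY]
    · rw [← neg_mem_iff]
      exact Ideal.subset_span ⟨i, by simp [subY]⟩

lemma subX_zero (a : Fin n → k) (f : Cox k n m) (hf : f ∈ Ia n m a) :
    aeval (subX m a) f = 0 := by
  have : Ia n m a ≤ RingHom.ker (aeval (subX m a) : Cox k n m →ₐ[k] Cox k n m) := by
    refine Ideal.span_le.2 ?_
    rintro _ ⟨i, rfl⟩
    simp [subX, RingHom.mem_ker, MvPolynomial.algebraMap_eq]
  exact this hf

lemma subY_zero (b : Fin m → k) (f : Cox k n m) (hf : f ∈ Ib n m b) :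
    aeval (subY n b) f = 0 := by
  have : Ib n m b ≤ RingHom.ker (aeval (subY n b) : Cox k n m →ₐ[k] Cox k n m) := by
    refine Ideal.span_le.2 ?_
    rintro _ ⟨i, rfl⟩
    simp [subY, RingHom.mem_ker, MvPolynomial.algebraMap_eq]
  exact this hf

lemma subX_Ib (a : Fin n → k) (b : Fin m → k) (f : Cox k n m) (hf : f ∈ Ib n m b) :
    aeval (subX m a) f ∈ Ib n m b := by
  have : Ib n m b ≤ (Ib n m b).comap (aeval (subX m a) : Cox k n m →ₐ[k] Cox k n m) := by
    refine Ideal.span_le.2 ?_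
    rintro _ ⟨i, rfl⟩
    refine Ideal.subset_span ⟨i, ?_⟩
    simp [subX, MvPolynomial.algebraMap_eq]
  exact this hf

lemma mem_IXk_iff {ℓ : ℕ} (P : Fin ℓ → Fin n → k) (r : Fin ℓ → ℕ)
    (Q : (a : Fin ℓ) → Fin (r a) → Fin m → k) (a : Fin ℓ) (f : Cox k n m) :
    f ∈ IXk n m P r Q a ↔
      ∀ j, aeval (subY n (Q a j)) (aeval (subX m (P a)) f) = 0 := by
  constructor
  · intro h j
    obtain ⟨u, hu, v, hv, rfl⟩ := Submodule.mem_sup.1 h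
    rw [map_add, subX_zero _ _ hu, zero_add]
    exact subY_zero _ _ (subX_Ib _ _ _ ((Ideal.mem_iInf.1 hv) j))
  · intro h
    refine Submodule.mem_sup.2 ⟨_, subX_mem (P a) f, aeval (subX m (P a)) f, ?_, by ring⟩
    refine Ideal.mem_iInf.2 fun j => ?_
    have := subY_mem (Q a j) (aeval (subX m (P a)) f)
    rwa [h j, sub_zero] at this

/-- **First step of Theorem 1.1**: with `B = ⟨x⟩ ∩ ⟨y⟩` the irrelevant ideal and any
`t ≥ 0`, the `B`-saturation of `I_X ∩ ⟨x⟩^t` equals `I_X`: for every `f ∈ S`,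
`f ∈ I_X` iff there is `s ∈ ℕ` with `f · B^s ⊆ I_X ∩ ⟨x⟩^t`. -/
theorem stmt9 (k : Type*) [Field k] [IsAlgClosed k] (n m : ℕ) (hn : 1 ≤ n) (hm : 1 ≤ m)
    (ℓ : ℕ) (hℓ : 1 ≤ ℓ)
    (P : Fin ℓ → Fin n → k) (hP : Function.Injective P)
    (r : Fin ℓ → ℕ) (hr : ∀ a, 1 ≤ r a)
    (Q : (a : Fin ℓ) → Fin (r a) → Fin m → k)
    (hQ : ∀ a, Function.Injective (Q a))
    (t : ℕ) :
    ∀ f : Cox k n m,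
      f ∈ ⨅ a : Fin ℓ, IXk n m P r Q a ↔
        ∃ s : ℕ, ∀ g ∈ (xIdeal k n m ⊓ yIdeal k n m) ^ s,
          f * g ∈ (⨅ a : Fin ℓ, IXk n m P r Q a) ⊓ xIdeal k n m ^ t := by
  intro f
  constructor
  · intro hf
    refine ⟨t, fun g hg => ⟨Ideal.mul_mem_right _ _ hf, Ideal.mul_mem_left _ _ ?_⟩⟩
    exact Ideal.pow_right_mono inf_le_left t hg
  · rintro ⟨s, hs⟩
    have hB : (X (Sum.inl 0) * X (Sum.inr 0) : Cox k n m) ∈ xIdeal k n m ⊓ yIdeal k n m :=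
      ⟨Ideal.mul_mem_right _ _ (Ideal.subset_span ⟨0, rfl⟩),
        Ideal.mul_mem_left _ _ (Ideal.subset_span ⟨0, rfl⟩)⟩
    have h1 := (hs _ (Ideal.pow_mem_pow hB s)).1
    refine Ideal.mem_iInf.2 fun a => (mem_IXk_iff P r Q a f).2 fun j => ?_
    have h2 := (mem_IXk_iff P r Q a _).1 (Ideal.mem_iInf.1 h1 a) j
    rw [map_mul, map_mul] at h2
    refine (mul_eq_zero.1 h2).resolve_right ?_
    have h3 : aeval (subY n (Q a j)) (aeval (subX m (P a))
        ((X (Sum.inl 0) * X (Sum.inr 0) : Cox k n m) ^ s)) =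
        (X (Sum.inl 0) * X (Sum.inr 0) : Cox k n m) ^ s := by
      simp [subX, subY]
    rw [h3]
    exact pow_ne_zero _ (mul_ne_zero (X_ne_zero _) (X_ne_zero _))
end
end

section
/- Set ΔH := Δ^C Δ^R H. Then for all i ≥ 0: ΔH(i,0) = 1 if 0 ≤ i ≤ N−1 and 0 if i ≥ N; ΔH(i,1) = 2 if 0 ≤ i ≤ q′−1, = r′−1 if i = q′, = −1 if q′+1 ≤ i ≤ N−1, and = 0 if i ≥ N; ΔH(i,2) = 3 if 0 ≤ i ≤ q−1, = r−3 if i = q, = −3 if q+1 ≤ i ≤ q′−1, = −r′ if i = q′, and = 0 if i ≥ q′+1. -/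
noncomputable section

/-- The column difference operator `(Δ^C H)(i,j) = H(i,j) - H(i-1,j)`. -/
def deltaC (H : ℤ → ℤ → ℤ) : ℤ → ℤ → ℤ := fun i j => H i j - H (i - 1) j

/-- The row difference operator `(Δ^R H)(i,j) = H(i,j) - H(i,j-1)`. -/
def deltaR (H : ℤ → ℤ → ℤ) : ℤ → ℤ → ℤ := fun i j => H i j - H i (j - 1)

theorem stmt13 (N q r q' r' : ℕ) (hN : 12 ≤ N)
    (hqr : N = 6 * q + r) (hr : r ≤ 5)
    (hq'r' : N = 3 * q' + r') (hr' : r' ≤ 2)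
    (H : ℤ → ℤ → ℤ)
    (hH : ∀ i j : ℤ, H i j =
      if 0 ≤ i ∧ 0 ≤ j then
        min (N : ℤ) ((i + 1) * ((j.toNat + 2).choose 2 : ℤ))
      else 0)
    (DH : ℤ → ℤ → ℤ) (hDH : DH = deltaC (deltaR H)) :
    (∀ i : ℤ, 0 ≤ i → i ≤ (N : ℤ) - 1 → DH i 0 = 1) ∧
    (∀ i : ℤ, (N : ℤ) ≤ i → DH i 0 = 0) ∧
    (∀ i : ℤ, 0 ≤ i → i ≤ (q' : ℤ) - 1 → DH i 1 = 2) ∧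
    (DH (q' : ℤ) 1 = (r' : ℤ) - 1) ∧
    (∀ i : ℤ, (q' : ℤ) + 1 ≤ i → i ≤ (N : ℤ) - 1 → DH i 1 = -1) ∧
    (∀ i : ℤ, (N : ℤ) ≤ i → DH i 1 = 0) ∧
    (∀ i : ℤ, 0 ≤ i → i ≤ (q : ℤ) - 1 → DH i 2 = 3) ∧
    (DH (q : ℤ) 2 = (r : ℤ) - 3) ∧
    (∀ i : ℤ, (q : ℤ) + 1 ≤ i → i ≤ (q' : ℤ) - 1 → DH i 2 = -3) ∧
    (DH (q' : ℤ) 2 = -(r' : ℤ)) ∧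
    (∀ i : ℤ, (q' : ℤ) + 1 ≤ i → DH i 2 = 0) := by
  have h0 : ∀ i : ℤ, H i (-1) = 0 := by
    intro i; rw [hH]; simp
  have h1 : ∀ i : ℤ, H i 0 = if 0 ≤ i then min (N : ℤ) (i + 1) else 0 := by
    intro i; rw [hH]; simp
  have h2 : ∀ i : ℤ, H i 1 = if 0 ≤ i then min (N : ℤ) ((i + 1) * 3) else 0 := by
    intro i; rw [hH]; simp [Nat.choose]
  have h3 : ∀ i : ℤ, H i 2 = if 0 ≤ i then min (N : ℤ) ((i + 1) * 6) else 0 := by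
    intro i; rw [hH]; simp [Nat.choose]
  have d0 : ∀ i : ℤ, DH i 0 = H i 0 - H (i - 1) 0 := by
    intro i; subst hDH; simp [deltaC, deltaR, h0]
  have d1 : ∀ i : ℤ, DH i 1 = H i 1 - H i 0 - (H (i - 1) 1 - H (i - 1) 0) := by
    intro i; subst hDH; simp [deltaC, deltaR]
  have d2 : ∀ i : ℤ, DH i 2 = H i 2 - H i 1 - (H (i - 1) 2 - H (i - 1) 1) := by
    intro i; subst hDH; simp [deltaC, deltaR]
  clear hH hDH
  simp only [d0, d1, d2, h1, h2, h3]
  clear h0 h1 h2 h3 d0 d1 d2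
  refine ⟨?_, ?_, ?_, ?_, ?_, ?_, ?_, ?_, ?_, ?_, ?_⟩ <;> intros <;> split_ifs <;> omega
end
end

section
/- Set DH := (Δ^C)² (Δ^R)³ H. Then for all i ≥ 0 and j ∈ {0,1,2}: DH(i,0) equals 1 if i = 0, −1 if i = N, and 0 otherwise; DH(i,1) equals r′−3 if i = q′, −r′ if i = q′+1, 3 if i = N, and 0 otherwise; DH(i,2) equals r−6 if i = q, −r if i = q+1, 9−3r′ if i = q′, 3r′ if i = q′+1, −3 if i = N, and 0 otherwise. -/
noncomputable section

theorem stmt14 (N q r q' r' : ℕ) (hN : 12 ≤ N)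
    (hqr : N = 6 * q + r) (hr : r ≤ 5)
    (hq'r' : N = 3 * q' + r') (hr' : r' ≤ 2)
    (H : ℤ → ℤ → ℤ)
    (hH : ∀ i j : ℤ, H i j =
      if 0 ≤ i ∧ 0 ≤ j then
        min (N : ℤ) ((i + 1) * ((j.toNat + 2).choose 2 : ℤ))
      else 0)
    (DH : ℤ → ℤ → ℤ) (hDH : DH = deltaC^[2] (deltaR^[3] H)) :
    (DH 0 0 = 1) ∧ (DH (N : ℤ) 0 = -1) ∧
    (∀ i : ℤ, 0 ≤ i → i ≠ 0 → i ≠ (N : ℤ) → DH i 0 = 0) ∧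
    (DH (q' : ℤ) 1 = (r' : ℤ) - 3) ∧
    (DH ((q' : ℤ) + 1) 1 = -(r' : ℤ)) ∧
    (DH (N : ℤ) 1 = 3) ∧
    (∀ i : ℤ, 0 ≤ i → i ≠ (q' : ℤ) → i ≠ (q' : ℤ) + 1 → i ≠ (N : ℤ) → DH i 1 = 0) ∧
    (DH (q : ℤ) 2 = (r : ℤ) - 6) ∧
    (DH ((q : ℤ) + 1) 2 = -(r : ℤ)) ∧
    (DH (q' : ℤ) 2 = 9 - 3 * (r' : ℤ)) ∧
    (DH ((q' : ℤ) + 1) 2 = 3 * (r' : ℤ)) ∧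
    (DH (N : ℤ) 2 = -3) ∧
    (∀ i : ℤ, 0 ≤ i → i ≠ (q : ℤ) → i ≠ (q : ℤ) + 1 → i ≠ (q' : ℤ) →
      i ≠ (q' : ℤ) + 1 → i ≠ (N : ℤ) → DH i 2 = 0) := by
  have h0 : ∀ i : ℤ, H i 0 = if 0 ≤ i then min (N : ℤ) (i + 1) else 0 := by
    intro i; rw [hH]; simp
  have h1 : ∀ i : ℤ, H i 1 = if 0 ≤ i then min (N : ℤ) ((i + 1) * 3) else 0 := by
    intro i; rw [hH]; simp [Nat.choose]
  have h2 : ∀ i : ℤ, H i 2 = if 0 ≤ i then min (N : ℤ) ((i + 1) * 6) else 0 := by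
    intro i; rw [hH]; simp [Nat.choose]
  have hm : ∀ i j : ℤ, j < 0 → H i j = 0 := by
    intro i j hj; rw [hH, if_neg (by omega)]
  have s0 : ∀ i : ℤ, 0 ≤ i → H i 0 - 2 * H (i - 1) 0 + H (i - 2) 0 =
      (if i = 0 then 1 else 0) + (if i = N then -1 else 0) := by
    intro i hi; simp only [h0]; split_ifs <;> omega
  have s1 : ∀ i : ℤ, 0 ≤ i → H i 1 - 2 * H (i - 1) 1 + H (i - 2) 1 =
      (if i = 0 then 3 else 0) + (if i = q' then (r' : ℤ) - 3 else 0)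
        + (if i = q' + 1 then -(r' : ℤ) else 0) := by
    intro i hi; simp only [h1]; split_ifs <;> omega
  have s2 : ∀ i : ℤ, 0 ≤ i → H i 2 - 2 * H (i - 1) 2 + H (i - 2) 2 =
      (if i = 0 then 6 else 0) + (if i = q then (r : ℤ) - 6 else 0)
        + (if i = q + 1 then -(r : ℤ) else 0) := by
    intro i hi; simp only [h2]; split_ifs <;> omega
  have d : ∀ i j : ℤ, DH i j =
      (H i j - 2 * H (i - 1) j + H (i - 2) j)
      - 3 * (H i (j-1) - 2 * H (i - 1) (j-1) + H (i - 2) (j-1))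
      + 3 * (H i (j-2) - 2 * H (i - 1) (j-2) + H (i - 2) (j-2))
      - (H i (j-3) - 2 * H (i - 1) (j-3) + H (i - 2) (j-3)) := by
    intro i j
    rw [hDH]
    simp only [Function.iterate_succ, Function.iterate_zero, Function.comp, id, deltaC, deltaR]
    rw [show i - 1 - 1 = i - 2 by ring, show j - 1 - 1 = j - 2 by ring,
      show j - 2 - 1 = j - 3 by ring]
    ring
  have d0 : ∀ i : ℤ, 0 ≤ i → DH i 0 =
      (if i = 0 then 1 else 0) + (if i = N then -1 else 0) := by
    intro i hi
    rw [d, s0 i hi]; simp [hm]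
  have d1 : ∀ i : ℤ, 0 ≤ i → DH i 1 =
      (if i = q' then (r' : ℤ) - 3 else 0)
        + (if i = q' + 1 then -(r' : ℤ) else 0) + (if i = N then 3 else 0) := by
    intro i hi
    rw [d, s1 i hi, show (1 : ℤ) - 1 = 0 by norm_num, s0 i hi]
    simp only [hm _ (1 - 2) (by norm_num), hm _ (1 - 3) (by norm_num)]
    split_ifs <;> omega
  have d2 : ∀ i : ℤ, 0 ≤ i → DH i 2 =
      (if i = q then (r : ℤ) - 6 else 0) + (if i = q + 1 then -(r : ℤ) else 0)
        + (if i = q' then 9 - 3 * (r' : ℤ) else 0)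
        + (if i = q' + 1 then 3 * (r' : ℤ) else 0) + (if i = N then -3 else 0) := by
    intro i hi
    rw [d, s2 i hi, show (2 : ℤ) - 1 = 1 by norm_num, s1 i hi,
      show (2 : ℤ) - 2 = 0 by norm_num, s0 i hi]
    simp only [hm _ (2 - 3) (by norm_num)]
    split_ifs <;> omega
  refine ⟨?_, ?_, ?_, ?_, ?_, ?_, ?_, ?_, ?_, ?_, ?_, ?_, ?_⟩
  · rw [d0 _ (by omega)]; split_ifs <;> omega
  · rw [d0 _ (by omega)]; split_ifs <;> omega
  · intro i hi _ _; rw [d0 _ hi]; split_ifs <;> omega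
  · rw [d1 _ (by omega)]; split_ifs <;> omega
  · rw [d1 _ (by omega)]; split_ifs <;> omega
  · rw [d1 _ (by omega)]; split_ifs <;> omega
  · intro i hi _ _ _; rw [d1 _ hi]; split_ifs <;> omega
  · rw [d2 _ (by omega)]; split_ifs <;> omega
  · rw [d2 _ (by omega)]; split_ifs <;> omega
  · rw [d2 _ (by omega)]; split_ifs <;> omega
  · rw [d2 _ (by omega)]; split_ifs <;> omega
  · rw [d2 _ (by omega)]; split_ifs <;> omega
  · intro i hi _ _ _ _ _; rw [d2 _ hi]; split_ifs <;> omega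
end
end

section
/- Let S = k[x_0,…,x_n,y_0,y_1], let a = (a_1,…,a_n) ∈ kⁿ, and let b_1,…,b_r ∈ k be pairwise distinct with r ≥ 1. Then ⟨a_1x_0−x_1,…,a_nx_0−x_n⟩ + ⋂_{j=1}^{r} ⟨b_j·y_0 − y_1⟩ + ⟨y_0⟩ = ⟨a_1x_0−x_1,…,a_nx_0−x_n, y_0, y_1^r⟩ as ideals of S. -/
open MvPolynomial

noncomputable section

/-- The Cox ring `S = k[x_0,…,x_n, y_0, y_1]` of `ℙⁿ × ℙ¹`. -/
abbrev CoxP1 (k : Type*) [Field k] (n : ℕ) : Type _ :=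
  MvPolynomial (Fin (n + 1) ⊕ Fin 2) k

theorem aux_relprime {k : Type*} [Field k] {σ : Type*} {u v : σ} (huv : u ≠ v) (b c : k)
    (hbc : b ≠ c) :
    IsRelPrime (C b * X u - X v : MvPolynomial σ k) (C c * X u - X v) := by
  intro d h1 h2
  have h3 : d ∣ (X u : MvPolynomial σ k) := by
    have h := dvd_mul_of_dvd_right (dvd_sub h1 h2) (C (b - c)⁻¹)
    have e : C (b - c)⁻¹ * ((C b * X u - X v) - (C c * X u - X v)) = (X u : MvPolynomial σ k) := by
      have : (C (b - c)⁻¹ * C (b - c) : MvPolynomial σ k) = 1 := by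
        rw [← C_mul, inv_mul_cancel₀ (sub_ne_zero.2 hbc), C_1]
      rw [C_sub] at this
      linear_combination (X u) * this
    rwa [e] at h
  have h4 : d ∣ (X v : MvPolynomial σ k) := by
    have h := dvd_sub (dvd_mul_of_dvd_right h3 (C b)) h1
    simpa using h
  by_contra hd
  have h5 : (X u : MvPolynomial σ k) ∣ d := by
    have hp : Irreducible (X u : MvPolynomial σ k) := (X_prime (i := u)).irreducible
    exact ((hp.dvd_iff.1 h3).resolve_left hd).dvd
  have h6 := h5.trans h4
  rw [X_dvd_X] at h6
  simp_all

theorem aux_mod {k : Type*} [Field k] {σ : Type*} (u v : σ) (r : ℕ) (b : Fin r → k) :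
    (X u : MvPolynomial σ k) ∣ (∏ j, (C (b j) * X u - X v)) - (-1) ^ r * X v ^ r := by
  rw [← Ideal.mem_span_singleton, ← Ideal.Quotient.eq]
  have h : Ideal.Quotient.mk (Ideal.span {(X u : MvPolynomial σ k)}) (X u) = 0 :=
    Ideal.Quotient.eq_zero_iff_mem.2 (Ideal.mem_span_singleton_self _)
  rw [map_prod]
  simp only [map_sub, map_mul, h, mul_zero, zero_sub, Finset.prod_const, Finset.card_univ,
    Fintype.card_fin, map_pow, map_neg, map_one]
  rw [← mul_pow, neg_one_mul]

theorem aux_span {R : Type*} [CommRing R] (p u v q : R) (r : ℕ)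
    (hq : p - (-1) ^ r * v ^ r = u * q) :
    Ideal.span {p} ⊔ Ideal.span {u} = Ideal.span {u, v ^ r} := by
  rw [← Ideal.span_union, Set.singleton_union]
  apply le_antisymm
  · rw [Ideal.span_le]
    rintro x (rfl | rfl)
    · refine Ideal.mem_span_pair.2 ⟨q, (-1) ^ r, ?_⟩
      linear_combination -hq
    · exact Ideal.subset_span (by simp)
  · rw [Ideal.span_le]
    rintro x (rfl | rfl)
    · exact Ideal.subset_span (by simp)
    · refine Ideal.mem_span_pair.2 ⟨(-1) ^ r, -(-1) ^ r * q, ?_⟩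
      have h1 : ((-1) ^ r * (-1) ^ r : R) = 1 := by
        rw [← mul_pow]; simp
      linear_combination (-1) ^ r * hq + v ^ r * h1

theorem aux_inf {R : Type*} [CommRing R] [DecompositionMonoid R] {r : ℕ} (l : Fin r → R)
    (hl : ∀ i j, i ≠ j → IsRelPrime (l i) (l j)) :
    (⨅ j, Ideal.span {l j}) = Ideal.span {∏ j, l j} := by
  ext f
  simp only [Ideal.mem_iInf, Ideal.mem_span_singleton]
  constructor
  · intro h
    apply Finset.prod_dvd_of_isRelPrime
    · intro i _ j _ hij
      exact hl i j hij
    · intro j _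
      exact h j
  · intro h j
    exact (Finset.dvd_prod_of_mem l (Finset.mem_univ j)).trans h

/-- **Remark 2.8**: in `S = k[x_0,…,x_n,y_0,y_1]`, for `a ∈ kⁿ` and pairwise
distinct `b_1, …, b_r ∈ k` (`r ≥ 1`),
`⟨a_1x_0−x_1,…,a_nx_0−x_n⟩ + ⋂_{j=1}^{r} ⟨b_j y_0 − y_1⟩ + ⟨y_0⟩
  = ⟨a_1x_0−x_1,…,a_nx_0−x_n, y_0, y_1^r⟩`. -/
theorem stmt15 (k : Type*) [Field k] [IsAlgClosed k] (n : ℕ) (hn : 1 ≤ n)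
    (a : Fin n → k) (r : ℕ) (hr : 1 ≤ r)
    (b : Fin r → k) (hb : Function.Injective b) :
    Ideal.span (Set.range fun i : Fin n =>
        (C (a i) * X (Sum.inl 0) - X (Sum.inl i.succ) : CoxP1 k n)) +
      (⨅ j : Fin r,
        Ideal.span {(C (b j) * X (Sum.inr 0) - X (Sum.inr 1) : CoxP1 k n)}) +
      Ideal.span {(X (Sum.inr 0) : CoxP1 k n)} =
    Ideal.span ((Set.range fun i : Fin n =>
        (C (a i) * X (Sum.inl 0) - X (Sum.inl i.succ) : CoxP1 k n)) ∪
      {(X (Sum.inr 0) : CoxP1 k n), (X (Sum.inr 1) : CoxP1 k n) ^ r}) := by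
  have hne : (Sum.inr 0 : Fin (n + 1) ⊕ Fin 2) ≠ Sum.inr 1 := by simp
  have hinf : (⨅ j : Fin r,
        Ideal.span {(C (b j) * X (Sum.inr 0) - X (Sum.inr 1) : CoxP1 k n)}) =
      Ideal.span {∏ j, (C (b j) * X (Sum.inr 0) - X (Sum.inr 1) : CoxP1 k n)} := by
    exact aux_inf _ (fun i j hij => aux_relprime hne _ _ (fun e => hij (hb e)))
  obtain ⟨q, hq⟩ := aux_mod (Sum.inr 0 : Fin (n + 1) ⊕ Fin 2) (Sum.inr 1) r b
  rw [hinf, Ideal.span_union, add_assoc, Submodule.add_eq_sup, Submodule.add_eq_sup]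
  congr 1
  exact aux_span _ _ _ _ r hq
end
end
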